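/- arXiv:2003.05547 — 2 statements merged into one kernel-verified Lean document; each statement's English description precedes it below -/
import Mathlib

section
/- Let n ≥ 2 be an integer and r ≥ 0 a real number. Every spherical code C in ℝ^n with maximal inner product cosh(2r)/(1 + cosh(2r)) satisfies |C| ≤ 2·B((n−1)/2, 1/2) / B((sech r)²/4; (n−1)/2, 1/2). -/
open scoped RealInnerProductSpace

/-- The incomplete beta function `B(x; y, z) = ∫_0^x t^(y-1) (1-t)^(z-1) dt`.
`B(y, z) = incBeta 1 y z` is the (complete) beta function. -/
noncomputable def incBeta (x y z : ℝ) : ℝ :=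
  ∫ t in (0:ℝ)..x, t ^ (y - 1) * (1 - t) ^ (z - 1)

/-- A spherical code in `ℝ^n` with maximal inner product `t`: a finite set of
unit vectors whose pairwise inner products are at most `t`. -/
def IsSphericalCode (n : ℕ) (t : ℝ) (C : Finset (EuclideanSpace ℝ (Fin n))) : Prop :=
  (∀ x ∈ C, ‖x‖ = 1) ∧ ∀ x ∈ C, ∀ y ∈ C, x ≠ y → ⟪x, y⟫ ≤ t

section Sector

open MeasureTheory Set Module Metric
open scoped ENNReal

variable {F : Type*} [NormedAddCommGroup F] [InnerProductSpace ℝ F] [FiniteDimensional ℝ F]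
  [MeasurableSpace F] [BorelSpace F]

theorem lintegral_fun_norm_addHaar {E : Type*} [NormedAddCommGroup E] [NormedSpace ℝ E]
    [FiniteDimensional ℝ E] [Nontrivial E] [MeasurableSpace E] [BorelSpace E] (μ : Measure E)
    [μ.IsAddHaarMeasure] {f : ℝ → ℝ≥0∞} (hf : Measurable f) :
    ∫⁻ x, f ‖x‖ ∂μ =
      μ.toSphere univ * ∫⁻ y in Ioi (0 : ℝ), ENNReal.ofReal (y ^ (finrank ℝ E - 1)) * f y :=
  calc
    ∫⁻ x, f ‖x‖ ∂μ = ∫⁻ x : ({(0)}ᶜ : Set E), f ‖x.1‖ ∂(μ.comap (↑)) := by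
      rw [lintegral_subtype_comap (measurableSet_singleton _).compl fun x ↦ f ‖x‖,
        restrict_compl_singleton]
    _ = ∫⁻ x, f x.2 ∂μ.toSphere.prod (.volumeIoiPow (finrank ℝ E - 1)) := by
      simpa using μ.measurePreserving_homeomorphUnitSphereProd.lintegral_comp_emb
        (Homeomorph.measurableEmbedding _) (f ∘ Subtype.val ∘ Prod.snd)
    _ = μ.toSphere univ * ∫⁻ x : Ioi (0 : ℝ), f x ∂.volumeIoiPow (finrank ℝ E - 1) := by
      rw [lintegral_prod _ (by fun_prop)]
      simp [mul_comm]
    _ = _ := by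
      rw [Measure.volumeIoiPow,
        lintegral_withDensity_eq_lintegral_mul _ (by fun_prop) (by fun_prop)]
      congr 1
      exact lintegral_subtype_comap measurableSet_Ioi
        fun a ↦ ENNReal.ofReal (a ^ (finrank ℝ E - 1)) * f a

theorem setLIntegral_Ioo_zero_ofReal_pow (m : ℕ) {b : ℝ} (hb : 0 ≤ b) :
    ∫⁻ s in Ioo 0 b, ENNReal.ofReal (s ^ m) = ENNReal.ofReal (b ^ (m + 1) / (m + 1)) := by
  rw [Measure.restrict_congr_set Ioo_ae_eq_Ioc,
    ← ofReal_integral_eq_lintegral_ofReal (intervalIntegral.intervalIntegrable_pow _).1,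
    ← intervalIntegral.integral_of_le hb]
  · simp
  · filter_upwards [ae_restrict_mem measurableSet_Ioc] with y hy
    exact pow_nonneg hy.1.le _

/-- The part of the cone around the first axis of `ℝ × F` of half-angle `arcsin √x`
that lies in the unit ball. -/
def ballSector (F : Type*) [NormedAddCommGroup F] (x : ℝ) : Set (ℝ × F) :=
  {p | 0 < p.1 ∧ p.1 ^ 2 + ‖p.2‖ ^ 2 < 1 ∧ ‖p.2‖ ^ 2 < x * (p.1 ^ 2 + ‖p.2‖ ^ 2)}

theorem measurableSet_ballSector {F : Type*} [NormedAddCommGroup F] [MeasurableSpace F]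
    [OpensMeasurableSpace F] (x : ℝ) : MeasurableSet (ballSector F x) := by
  rw [ballSector, ofPred_and, ofPred_and]
  exact (measurableSet_lt (by fun_prop) (by fun_prop)).inter
    ((measurableSet_lt (by fun_prop) (by fun_prop)).inter
      (measurableSet_lt (by fun_prop) (by fun_prop)))

/-- The density of the (unnormalised) beta distribution. -/
noncomputable def betaDensity (y z t : ℝ) : ℝ := t ^ (y - 1) * (1 - t) ^ (z - 1)

theorem lintegral_betaDensity_eq (m : ℕ) (hm : 0 < m) {x : ℝ} (hx1 : x ≤ 1) :
    ∫⁻ t in Ioo 0 x, ENNReal.ofReal (betaDensity (m / 2) (1 / 2) t) =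
      ∫⁻ u in {u : ℝ | 0 < u ∧ u ^ 2 < x * (1 + u ^ 2)},
        ENNReal.ofReal (2 * (u ^ (m - 1) * (√(1 + u ^ 2))⁻¹ ^ (m + 1))) := by
  set S := {u : ℝ | 0 < u ∧ u ^ 2 < x * (1 + u ^ 2)} with hS
  have hSm : MeasurableSet S := by
    rw [hS, ofPred_and]
    exact (measurableSet_lt (by fun_prop) (by fun_prop)).inter
      (measurableSet_lt (by fun_prop) (by fun_prop))
  have himg : (fun u : ℝ ↦ u ^ 2 / (1 + u ^ 2)) '' S = Ioo 0 x := by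
    ext t
    constructor
    · rintro ⟨u, ⟨hu0, hu⟩, rfl⟩
      exact ⟨by positivity, by simpa only [div_lt_iff₀ (show 0 < 1 + u ^ 2 by positivity)]⟩
    · rintro ⟨ht0, ht⟩
      have h1 : 0 < 1 - t := by linarith
      have hsq : √(t / (1 - t)) ^ 2 = t / (1 - t) := Real.sq_sqrt (by positivity)
      refine ⟨√(t / (1 - t)), ⟨by positivity, ?_⟩, ?_⟩
      · rw [hsq]
        have : 1 + t / (1 - t) = 1 / (1 - t) := by field_simp; ring
        rw [this, ← mul_div_assoc, mul_one]
        gcongr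
      · simp only [hsq]
        field_simp
        ring
  have hinj : InjOn (fun u : ℝ ↦ u ^ 2 / (1 + u ^ 2)) S := by
    rintro u ⟨hu, -⟩ v ⟨hv, -⟩ h
    simp only at h
    rw [div_eq_div_iff (by positivity) (by positivity)] at h
    have : u ^ 2 = v ^ 2 := by linarith
    exact (sq_eq_sq₀ hu.le hv.le).1 this
  rw [← himg, lintegral_image_eq_lintegral_abs_deriv_mul hSm
    (f' := fun u ↦ 2 * u / (1 + u ^ 2) ^ 2) _ hinj]
  · refine setLIntegral_congr_fun hSm ?_
    rintro u ⟨hu, -⟩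
    have ha : 0 < 1 + u ^ 2 := by positivity
    simp only
    rw [← ENNReal.ofReal_mul (by positivity), abs_of_pos (by positivity)]
    congr 1
    have h1 : 1 - u ^ 2 / (1 + u ^ 2) = (√(1 + u ^ 2) ^ 2)⁻¹ := by
      rw [Real.sq_sqrt ha.le]; field_simp; ring
    have h2 : u ^ 2 / (1 + u ^ 2) = (u / √(1 + u ^ 2)) ^ 2 := by
      rw [div_pow, Real.sq_sqrt ha.le]
    have hs : 0 < √(1 + u ^ 2) := by positivity
    rw [betaDensity, h1, h2, ← inv_pow, ← Real.rpow_natCast_mul (by positivity),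
      ← Real.rpow_natCast_mul (by positivity)]
    nth_rw 1 [← Real.sq_sqrt ha.le]
    set a := √(1 + u ^ 2)
    have e1 : ((2 : ℕ) : ℝ) * ((m : ℝ) / 2 - 1) = ((m - 1 : ℕ) : ℝ) - 1 := by
      push_cast [Nat.cast_sub (show 1 ≤ m from hm)]; ring
    have e2 : ((2 : ℕ) : ℝ) * ((1 : ℝ) / 2 - 1) = -1 := by norm_num
    rw [e1, e2, Real.rpow_sub_one (by positivity), Real.rpow_natCast, Real.rpow_neg_one, div_pow]
    obtain ⟨k, rfl⟩ : ∃ k, m = k + 1 := ⟨m - 1, by omega⟩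
    simp only [Nat.add_sub_cancel, inv_pow]
    field_simp
    ring
  · intro u _
    have h : HasDerivAt (fun u : ℝ ↦ u ^ 2) (2 * u) u := by simpa using hasDerivAt_pow 2 u
    exact ((h.div (h.const_add 1) (by positivity)).congr_deriv (by ring)).hasDerivWithinAt

theorem volume_ballSector [Nontrivial F] {x : ℝ} (hx1 : x ≤ 1) :
    volume (ballSector F x) =
      (volume : Measure F).toSphere univ * ENNReal.ofReal ((2 * (finrank ℝ F + 1))⁻¹) *
      ∫⁻ t in Ioo 0 x, ENNReal.ofReal (betaDensity (finrank ℝ F / 2) (1 / 2) t) := by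
  set m := finrank ℝ F with hm
  have hmpos : 0 < m := finrank_pos
  set D' : Set (ℝ × F) :=
    {p | p.1 ^ 2 * (1 + ‖p.2‖ ^ 2) < 1 ∧ ‖p.2‖ ^ 2 < x * (1 + ‖p.2‖ ^ 2)} with hD'
  have hD'm : MeasurableSet D' := by
    rw [hD', ofPred_and]
    exact (measurableSet_lt (by fun_prop) (by fun_prop)).inter
      (measurableSet_lt (by fun_prop) (by fun_prop))
  have hslice (s : ℝ) : volume (Prod.mk s ⁻¹' ballSector F x) =
      (Ioi 0).indicator (fun s ↦ ENNReal.ofReal (s ^ m) * volume (Prod.mk s ⁻¹' D')) s := by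
    by_cases hs : 0 < s
    · rw [indicator_of_mem (mem_Ioi.2 hs), ← Measure.addHaar_smul_of_nonneg _ hs.le]
      congr 1
      ext w
      rw [mem_smul_set_iff_inv_smul_mem₀ hs.ne']
      simp only [ballSector, hD', mem_preimage, mem_ofPred_eq, norm_smul, norm_inv,
        Real.norm_eq_abs, abs_of_pos hs, hs, true_and]
      have h1 : s ^ 2 * (1 + (s⁻¹ * ‖w‖) ^ 2) = s ^ 2 + ‖w‖ ^ 2 := by field_simp
      rw [h1]
      have h2 : ‖w‖ ^ 2 = s ^ 2 * (s⁻¹ * ‖w‖) ^ 2 := by field_simp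
      have h3 : x * (s ^ 2 + ‖w‖ ^ 2) = s ^ 2 * (x * (1 + (s⁻¹ * ‖w‖) ^ 2)) := by
        rw [← h1]; ring
      rw [h3]
      nth_rw 2 [h2]
      rw [mul_lt_mul_iff_right₀ (by positivity)]
    · rw [indicator_of_notMem (by simpa using hs)]
      convert measure_empty (μ := (volume : Measure F))
      ext w
      simp [ballSector, hs]
  set h : ℝ → ℝ≥0∞ := {u : ℝ | u ^ 2 < x * (1 + u ^ 2)}.indicator
    (fun u ↦ ENNReal.ofReal ((√(1 + u ^ 2))⁻¹ ^ (m + 1) / (m + 1))) with hh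
  have hSm : MeasurableSet {u : ℝ | u ^ 2 < x * (1 + u ^ 2)} :=
    (isOpen_lt (by fun_prop) (by fun_prop)).measurableSet
  have hhm : Measurable h := by
    refine Measurable.indicator ?_ hSm
    fun_prop
  have hinner (v : F) : ∫⁻ s in Ioi (0 : ℝ), ENNReal.ofReal (s ^ m) * D'.indicator 1 (s, v) =
      h ‖v‖ := by
    by_cases hv : ‖v‖ ^ 2 < x * (1 + ‖v‖ ^ 2)
    · have ha : 0 < 1 + ‖v‖ ^ 2 := by positivity
      rw [hh, indicator_of_mem (by exact hv), ← setLIntegral_Ioo_zero_ofReal_pow _ (by positivity),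
        ← lintegral_indicator measurableSet_Ioi, ← lintegral_indicator measurableSet_Ioo]
      congr 1
      ext s
      by_cases hs : 0 < s
      · have : (s, v) ∈ D' ↔ s ∈ Ioo 0 (√(1 + ‖v‖ ^ 2))⁻¹ := by
          simp only [hD', mem_ofPred_eq, hv, and_true, mem_Ioo, hs, true_and]
          rw [lt_inv_comm₀ hs (by positivity), Real.sqrt_lt' (by positivity), inv_pow,
            lt_inv_comm₀ ha (by positivity), ← one_div, lt_div_iff₀ ha]
        by_cases hs' : (s, v) ∈ D'
        · rw [indicator_of_mem (mem_Ioi.2 hs), indicator_of_mem (this.1 hs'), indicator_of_mem hs']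
          simp
        · rw [indicator_of_mem (mem_Ioi.2 hs), indicator_of_notMem (fun h ↦ hs' (this.2 h)),
            indicator_of_notMem hs']
          simp
      · simp [hs]
    · rw [hh, indicator_of_notMem (by exact hv)]
      have (s : ℝ) : (s, v) ∉ D' := fun h ↦ hv h.2
      simp [this]
  calc volume (ballSector F x)
    _ = ∫⁻ s in Ioi (0 : ℝ), ENNReal.ofReal (s ^ m) * volume (Prod.mk s ⁻¹' D') := by
      rw [Measure.volume_eq_prod, Measure.prod_apply (measurableSet_ballSector x),
        ← lintegral_indicator measurableSet_Ioi]
      simp_rw [hslice]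
    _ = ∫⁻ s in Ioi (0 : ℝ), ∫⁻ v : F, ENNReal.ofReal (s ^ m) * D'.indicator 1 (s, v) := by
      refine lintegral_congr fun s ↦ ?_
      rw [lintegral_const_mul _ (by
        exact (measurable_one.indicator hD'm).comp measurable_prodMk_left)]
      rw [← lintegral_indicator_one (hD'm.preimage measurable_prodMk_left)]
      rfl
    _ = ∫⁻ v : F, ∫⁻ s in Ioi (0 : ℝ), ENNReal.ofReal (s ^ m) * D'.indicator 1 (s, v) := by
      refine lintegral_lintegral_swap (Measurable.aemeasurable ?_)
      exact Measurable.mul (by fun_prop) (measurable_one.indicator hD'm)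
    _ = ∫⁻ v : F, h ‖v‖ := by simp_rw [hinner]
    _ = _ := by
      rw [lintegral_fun_norm_addHaar _ hhm, mul_assoc, lintegral_betaDensity_eq m hmpos hx1]
      congr 1
      rw [← lintegral_const_mul _ (by fun_prop)]
      have hset : {u : ℝ | 0 < u ∧ u ^ 2 < x * (1 + u ^ 2)} =
        Ioi 0 ∩ {u : ℝ | u ^ 2 < x * (1 + u ^ 2)} := rfl
      rw [hset, ← lintegral_indicator measurableSet_Ioi,
        ← lintegral_indicator (measurableSet_Ioi.inter hSm)]
      refine lintegral_congr fun u ↦ ?_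
      by_cases hu : 0 < u
      · by_cases hu' : u ∈ {u : ℝ | u ^ 2 < x * (1 + u ^ 2)}
        · rw [indicator_of_mem (mem_Ioi.2 hu), indicator_of_mem (mem_inter (mem_Ioi.2 hu) hu'), hh,
            indicator_of_mem hu', ← ENNReal.ofReal_mul (by positivity),
            ← ENNReal.ofReal_mul (by positivity)]
          congr 1
          field_simp
          simp [hm]
        · rw [indicator_of_mem (mem_Ioi.2 hu), indicator_of_notMem (fun h ↦ hu' h.2), hh,
            indicator_of_notMem hu', mul_zero]
      · rw [indicator_of_notMem (by simpa using hu), indicator_of_notMem (fun h ↦ hu h.1)]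


variable {E : Type*} [NormedAddCommGroup E] [InnerProductSpace ℝ E] [FiniteDimensional ℝ E]
  [MeasurableSpace E] [BorelSpace E]

/-- The part of the cone `{v | c * ‖v‖ < ⟪e, v⟫}` that lies in the unit ball. -/
def ballCone (e : E) (c : ℝ) : Set E := {v | ‖v‖ < 1 ∧ c * ‖v‖ < ⟪e, v⟫}

theorem measurableSet_ballCone (e : E) (c : ℝ) : MeasurableSet (ballCone e c) := by
  rw [ballCone, ofPred_and]
  exact (measurableSet_lt (by fun_prop) (by fun_prop)).inter
    (measurableSet_lt (by fun_prop) (by fun_prop))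

theorem exists_linearIsometryEquiv_prod {E F : Type*} [NormedAddCommGroup E]
    [InnerProductSpace ℝ E] [FiniteDimensional ℝ E] [NormedAddCommGroup F] [InnerProductSpace ℝ F]
    [FiniteDimensional ℝ F] (h : finrank ℝ E = finrank ℝ F + 1) {e : E}
    (he : ‖e‖ = 1) :
    ∃ ψ : E ≃ₗᵢ[ℝ] WithLp 2 (ℝ × F), ψ e = WithLp.toLp 2 (1, 0) := by
  have hW : finrank ℝ (WithLp 2 (ℝ × F)) = finrank ℝ E := by
    rw [(WithLp.linearEquiv 2 ℝ (ℝ × F)).finrank_eq, finrank_prod, finrank_self, h, add_comm]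
  let φ : E ≃ₗᵢ[ℝ] WithLp 2 (ℝ × F) := (stdOrthonormalBasis ℝ E).repr.trans
    ((stdOrthonormalBasis ℝ (WithLp 2 (ℝ × F))).reindex (finCongr hW)).repr.symm
  set p : WithLp 2 (ℝ × F) := WithLp.toLp 2 (1, 0) with hp
  have hp1 : ‖p‖ = 1 := by
    rw [← sq_eq_sq₀ (norm_nonneg _) zero_le_one, WithLp.prod_norm_sq_eq_of_L2]
    simp [hp]
  refine ⟨φ.trans (Submodule.reflection (ℝ ∙ (φ e - p))ᗮ), ?_⟩
  rw [LinearIsometryEquiv.trans_apply]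
  exact Submodule.reflection_sub (by rw [φ.norm_map, he, hp1])

theorem volume_ballCone (h : finrank ℝ E = finrank ℝ F + 1) {e : E} (he : ‖e‖ = 1) {c : ℝ}
    (hc : 0 ≤ c) : volume (ballCone e c) = volume (ballSector F (1 - c ^ 2)) := by
  obtain ⟨ψ, hψ⟩ := exists_linearIsometryEquiv_prod (F := F) h he
  have hmp : MeasurePreserving (fun v ↦ (ψ v).ofLp) :=
    (WithLp.volume_preserving_ofLp ℝ F).comp ψ.measurePreserving
  rw [← hmp.measure_preimage (measurableSet_ballSector _).nullMeasurableSet]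
  congr 1
  ext v
  have hin : ⟪e, v⟫ = (ψ v).ofLp.1 := by
    rw [← ψ.inner_map_map, hψ, WithLp.prod_inner_apply]
    simp
  have hnorm : ‖v‖ ^ 2 = (ψ v).ofLp.1 ^ 2 + ‖(ψ v).ofLp.2‖ ^ 2 := by
    rw [← ψ.norm_map, WithLp.prod_norm_sq_eq_of_L2]
    simp
  simp only [ballCone, ballSector, mem_preimage, mem_ofPred_eq, hin, ← hnorm]
  set s := (ψ v).ofLp.1
  have hv := norm_nonneg v
  constructor
  · rintro ⟨h1, h2⟩
    refine ⟨by nlinarith [mul_nonneg hc hv], by nlinarith, ?_⟩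
    nlinarith [mul_nonneg hc hv, pow_lt_pow_left₀ h2 (mul_nonneg hc hv) two_ne_zero]
  · rintro ⟨h1, h2, h3⟩
    refine ⟨by nlinarith, lt_of_pow_lt_pow_left₀ 2 h1.le ?_⟩
    nlinarith

theorem disjoint_ballCone {E : Type*} [NormedAddCommGroup E] [InnerProductSpace ℝ E]
    {x y : E} (hx : ‖x‖ = 1) (hy : ‖y‖ = 1) {c : ℝ} (hc : 0 ≤ c)
    (hxy : ⟪x, y⟫ ≤ 2 * c ^ 2 - 1) : Disjoint (ballCone x c) (ballCone y c) := by
  rw [Set.disjoint_left]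
  rintro v ⟨-, h1⟩ ⟨-, h2⟩
  have h3 : ‖x + y‖ ≤ 2 * c := by
    refine le_of_sq_le_sq ?_ (by positivity)
    rw [norm_add_sq_real, hx, hy]
    linarith
  have h4 : ⟪x + y, v⟫ ≤ 2 * c * ‖v‖ := (real_inner_le_norm _ _).trans (by gcongr)
  rw [inner_add_left] at h4
  linarith

theorem volume_ball_le (e : E) (he : ‖e‖ = 1) :
    volume (ball (0 : E) 1) ≤ volume (ballCone e 0) + volume (ballCone (-e) 0) := by
  have hsub : ball (0 : E) 1 ⊆ (ballCone e 0 ∪ ballCone (-e) 0) ∪ ((ℝ ∙ e)ᗮ : Submodule ℝ E) := by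
    intro v hv
    rw [mem_ball_zero_iff] at hv
    rcases lt_trichotomy ⟪e, v⟫ 0 with h | h | h
    · exact .inl (.inr ⟨hv, by rw [inner_neg_left]; linarith⟩)
    · exact .inr (Submodule.mem_orthogonal_singleton_iff_inner_right.2 h)
    · exact .inl (.inl ⟨hv, by linarith⟩)
  have hnull : volume (((ℝ ∙ e)ᗮ : Submodule ℝ E) : Set E) = 0 := by
    refine Measure.addHaar_submodule _ _ fun h ↦ ?_
    have : e ∈ (ℝ ∙ e)ᗮ := h ▸ Submodule.mem_top
    rw [Submodule.mem_orthogonal_singleton_iff_inner_right, real_inner_self_eq_norm_sq, he] at this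
    norm_num at this
  calc _ ≤ _ := measure_mono hsub
    _ ≤ _ := measure_union_le _ _
    _ ≤ _ := by rw [hnull, add_zero]; exact measure_union_le _ _

theorem card_mul_volume_ballSector_le (h : finrank ℝ E = finrank ℝ F + 1) {C : Finset E}
    (hC : ∀ x ∈ C, ‖x‖ = 1) {c : ℝ} (hc : 0 ≤ c)
    (hCc : ∀ x ∈ C, ∀ y ∈ C, x ≠ y → ⟪x, y⟫ ≤ 2 * c ^ 2 - 1) :
    C.card * volume (ballSector F (1 - c ^ 2)) ≤ 2 * volume (ballSector F 1) := by
  rcases C.eq_empty_or_nonempty with rfl | ⟨e, heC⟩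
  · simp
  calc C.card * volume (ballSector F (1 - c ^ 2))
    _ = ∑ x ∈ C, volume (ballCone x c) := by
      rw [Finset.sum_congr rfl fun x hx ↦ volume_ballCone h (hC x hx) hc]
      simp
    _ = volume (⋃ x ∈ C, ballCone x c) := by
      refine (measure_biUnion_finset (fun x hx y hy hxy ↦ ?_)
        fun x _ ↦ measurableSet_ballCone x c).symm
      exact disjoint_ballCone (hC x hx) (hC y hy) hc (hCc x hx y hy hxy)
    _ ≤ volume (ball (0 : E) 1) := by
      refine measure_mono (iUnion₂_subset fun x _ v hv ↦ ?_)
      simpa using hv.1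
    _ ≤ _ := volume_ball_le e (hC e heC)
    _ = _ := by
      rw [volume_ballCone h (hC e heC) le_rfl,
        volume_ballCone h (e := -e) (by rw [norm_neg]; exact hC e heC) le_rfl, two_mul]
      simp

theorem volume_ballSector_lt_top (x : ℝ) : volume (ballSector F x) < ∞ := by
  refine (measure_mono (t := ball 0 1) fun p hp ↦ ?_).trans_lt measure_ball_lt_top
  obtain ⟨-, hp, -⟩ := hp
  rw [mem_ball_zero_iff, Prod.norm_def, max_lt_iff]
  refine ⟨?_, ?_⟩
  · rw [Real.norm_eq_abs, ← sq_lt_one_iff_abs_lt_one]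
    nlinarith [sq_nonneg ‖p.2‖]
  · nlinarith [sq_nonneg p.1, norm_nonneg p.2]

theorem card_le_incBeta_div (hF : 0 < finrank ℝ F) (h : finrank ℝ E = finrank ℝ F + 1)
    {C : Finset E} (hC : ∀ x ∈ C, ‖x‖ = 1) {c : ℝ} (hc0 : 0 ≤ c) (hc1 : c < 1)
    (hCc : ∀ x ∈ C, ∀ y ∈ C, x ≠ y → ⟪x, y⟫ ≤ 2 * c ^ 2 - 1) :
    (C.card : ℝ) ≤ 2 * incBeta 1 (finrank ℝ F / 2) (1 / 2) /
      incBeta (1 - c ^ 2) (finrank ℝ F / 2) (1 / 2) := by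
  have : Nontrivial F := finrank_pos_iff.1 hF
  set f := betaDensity (finrank ℝ F / 2) (1 / 2)
  set A : ℝ → ℝ≥0∞ := fun x ↦ ∫⁻ t in Ioo 0 x, ENNReal.ofReal (f t) with hA
  set K := (volume : Measure F).toSphere univ * ENNReal.ofReal ((2 * (finrank ℝ F + 1))⁻¹)
  have hK0 : K ≠ 0 := mul_ne_zero
    (by rw [Ne, Measure.measure_univ_eq_zero]; exact Measure.toSphere_ne_zero _)
    (by rw [Ne, ENNReal.ofReal_eq_zero, not_le]; positivity)
  have hKtop : K ≠ ∞ := ENNReal.mul_ne_top (measure_ne_top _ _) ENNReal.ofReal_ne_top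
  have hfm : Measurable f := by unfold f betaDensity; fun_prop
  have hfpos {t : ℝ} (ht0 : 0 < t) (ht1 : t < 1) : 0 < f t :=
    mul_pos (Real.rpow_pos_of_pos ht0 _) (Real.rpow_pos_of_pos (by linarith) _)
  have hvol {x : ℝ} (hx0 : 0 < x) (hx1 : x ≤ 1) : volume (ballSector F x) = K * A x :=
    volume_ballSector hx1
  have hAtop {x : ℝ} (hx0 : 0 < x) (hx1 : x ≤ 1) : A x ≠ ∞ := fun hx ↦ by
    have := volume_ballSector_lt_top (F := F) x
    rw [hvol hx0 hx1, hx, ENNReal.mul_top hK0] at this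
    exact this.false
  have hA0 {x : ℝ} (hx0 : 0 < x) (hx1 : x ≤ 1) : 0 < A x := by
    rw [hA, setLIntegral_pos_iff (by fun_prop)]
    refine (show 0 < volume (Ioo 0 x) by simpa using hx0).trans_le (measure_mono fun t ht ↦ ?_)
    refine ⟨?_, ht⟩
    simpa using hfpos ht.1 (ht.2.trans_le hx1)
  have hinc {x : ℝ} (hx0 : 0 < x) (hx1 : x ≤ 1) :
      incBeta x (finrank ℝ F / 2) (1 / 2) = (A x).toReal := by
    change ∫ t in (0 : ℝ)..x, f t = _
    rw [intervalIntegral.integral_of_le hx0.le, integral_Ioc_eq_integral_Ioo,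
      integral_eq_lintegral_of_nonneg_ae _ hfm.aestronglyMeasurable]
    filter_upwards [ae_restrict_mem measurableSet_Ioo] with t ht
    exact (hfpos ht.1 (ht.2.trans_le hx1)).le
  have hx0 : 0 < 1 - c ^ 2 := by nlinarith
  have hx1 : 1 - c ^ 2 ≤ 1 := by nlinarith
  have key := card_mul_volume_ballSector_le h hC hc0 hCc
  rw [hvol hx0 hx1, hvol one_pos le_rfl, mul_left_comm, mul_left_comm 2,
    ENNReal.mul_le_mul_iff_right hK0 hKtop] at key
  rw [hinc hx0 hx1, hinc one_pos le_rfl,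
    le_div_iff₀ (ENNReal.toReal_pos (hA0 hx0 hx1).ne' (hAtop hx0 hx1))]
  have := ENNReal.toReal_mono (ENNReal.mul_ne_top (by simp) (hAtop one_pos le_rfl)) key
  simpa using this

end Sector

theorem upper_bound_kappa_H (n : ℕ) (hn : 2 ≤ n) (r : ℝ) (hr : 0 ≤ r)
    (C : Finset (EuclideanSpace ℝ (Fin n)))
    (hC : IsSphericalCode n (Real.cosh (2 * r) / (1 + Real.cosh (2 * r))) C) :
    (C.card : ℝ) ≤
      2 * incBeta 1 ((n - 1) / 2) (1 / 2) /
        incBeta ((1 / Real.cosh r) ^ 2 / 4) ((n - 1) / 2) (1 / 2) := by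
  obtain ⟨m, rfl⟩ : ∃ m, n = m + 1 := ⟨n - 1, by omega⟩
  have hcosh := Real.one_le_cosh r
  set x := (1 / Real.cosh r) ^ 2 / 4 with hx
  have hx0 : 0 < x := by positivity
  have hx1 : x ≤ 1 / 4 := by
    have : (1 / Real.cosh r) ^ 2 ≤ 1 := pow_le_one₀ (by positivity) (by
      rw [div_le_one (by positivity)]; exact hcosh)
    linarith
  have hsq : √(1 - x) ^ 2 = 1 - x := Real.sq_sqrt (by linarith)
  have ht : Real.cosh (2 * r) / (1 + Real.cosh (2 * r)) = 2 * √(1 - x) ^ 2 - 1 := by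
    rw [hsq, hx, Real.cosh_two_mul, Real.sinh_sq]
    have h1 : 1 + (Real.cosh r ^ 2 + (Real.cosh r ^ 2 - 1)) ≠ 0 := by nlinarith
    field_simp
    ring
  have := card_le_incBeta_div (F := EuclideanSpace ℝ (Fin m)) (by simp; omega) (by simp) hC.1
    (Real.sqrt_nonneg (1 - x)) (by rw [Real.sqrt_lt' one_pos]; linarith)
    (fun u hu v hv huv ↦ ht ▸ hC.2 u hu v hv huv)
  rw [hsq, sub_sub_cancel, finrank_euclideanSpace_fin] at this
  simpa using this
end

section
/- Let n ≥ 2 be an integer. There exist real constants 0 < c ≤ C and r₀ ≥ 0 such that for all r ≥ r₀: (i) every spherical code in ℝ^n with maximal inner product cosh(2r)/(1 + cosh(2r)) has cardinality at most C·e^{(n−1)r}; and (ii) there exists a spherical code in ℝ^n with maximal inner product cosh(2r)/(1 + cosh(2r)) whose cardinality is at least c·e^{(n−1)r}. -/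
open scoped RealInnerProductSpace

open MeasureTheory Metric Module in
theorem measureReal_ball_eq_pow_finrank_mul {E : Type*} [NormedAddCommGroup E] [NormedSpace ℝ E]
    [MeasurableSpace E] [BorelSpace E] [FiniteDimensional ℝ E] (μ : Measure E)
    [μ.IsAddHaarMeasure] (x : E) {r : ℝ} (hr : 0 < r) :
    μ.real (ball x r) = r ^ finrank ℝ E * μ.real (ball 0 1) := by
  rw [measureReal_def, measureReal_def, Measure.addHaar_ball_of_pos μ x hr, ENNReal.toReal_mul,
    ENNReal.toReal_ofReal (by positivity)]

/-- The chord of the graph of `s ↦ (1 + s) ^ n` over `[0, 1]` lies above the graph. -/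
theorem one_add_pow_le_one_add_mul {s : ℝ} (h0 : 0 ≤ s) (h1 : s ≤ 1) (n : ℕ) :
    (1 + s) ^ n ≤ 1 + (2 ^ n - 1) * s := by
  induction n with
  | zero => simp
  | succ n ih =>
    have h2 : (1 : ℝ) ≤ 2 ^ n := one_le_pow₀ one_le_two
    rw [pow_succ, pow_succ]
    nlinarith [mul_nonneg (mul_nonneg (sub_nonneg.2 h2) h0) (sub_nonneg.2 h1),
      mul_le_mul_of_nonneg_right ih (by linarith : 0 ≤ 1 + s)]

open MeasureTheory Metric Module in
/-- Volume bound for packings of the unit sphere. -/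
theorem card_mul_pow_le_of_pairwise_le_dist {E : Type*} [NormedAddCommGroup E] [NormedSpace ℝ E]
    [FiniteDimensional ℝ E] {s : ℝ} (hs0 : 0 < s) (hs1 : s < 1) {K : Finset E}
    (hK : ∀ x ∈ K, ‖x‖ = 1) (hd : ∀ x ∈ K, ∀ y ∈ K, x ≠ y → 2 * s ≤ dist x y) :
    (K.card : ℝ) * s ^ finrank ℝ E ≤ (1 + s) ^ finrank ℝ E - (1 - s) ^ finrank ℝ E := by
  borelize E
  let μ : Measure E := Measure.addHaar
  have hμ : 0 < μ.real (ball 0 1) :=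
    ENNReal.toReal_pos (measure_ball_pos μ 0 one_pos).ne' measure_ball_lt_top.ne
  have hdisj : (K : Set E).PairwiseDisjoint fun x ↦ ball x s := fun x hx y hy hxy ↦
    ball_disjoint_ball (by linarith [hd x hx y hy hxy])
  have hsub : (⋃ x ∈ K, ball x s) ∪ ball 0 (1 - s) ⊆ ball 0 (1 + s) := by
    refine Set.union_subset (Set.iUnion₂_subset fun x hx ↦ ball_subset_ball' ?_)
      (ball_subset_ball (by linarith))
    rw [dist_zero_right, hK x hx, add_comm]
  have hdisj' : Disjoint (⋃ x ∈ K, ball x s) (ball 0 (1 - s)) := by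
    simp only [Set.disjoint_iUnion_left]
    refine fun x hx ↦ ball_disjoint_ball ?_
    rw [dist_zero_right, hK x hx]
    linarith
  have h := measureReal_mono (μ := μ) hsub
  rw [measureReal_union hdisj' measurableSet_ball
      ((measure_mono (Set.subset_union_left.trans hsub)).trans_lt measure_ball_lt_top).ne,
    measureReal_biUnion_finset hdisj fun _ _ ↦ measurableSet_ball] at h
  simp only [measureReal_ball_eq_pow_finrank_mul μ _ hs0,
    measureReal_ball_eq_pow_finrank_mul μ _ (by linarith : 0 < 1 - s),
    measureReal_ball_eq_pow_finrank_mul μ _ (by linarith : 0 < 1 + s),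
    Finset.sum_const, nsmul_eq_mul] at h
  refine le_of_mul_le_mul_right ?_ hμ
  linarith

open MeasureTheory Metric Module in
/-- Volume bound for coverings of the unit sphere. -/
theorem sub_one_le_card_mul_pow_of_exists_dist_lt {E : Type*} [NormedAddCommGroup E]
    [NormedSpace ℝ E] [FiniteDimensional ℝ E] {δ : ℝ} (hδ : 0 < δ) {K : Finset E}
    (hK : ∀ u : E, ‖u‖ = 1 → ∃ x ∈ K, dist u x < δ) :
    (1 + δ) ^ finrank ℝ E - 1 ≤ K.card * (2 * δ) ^ finrank ℝ E := by
  borelize E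
  let μ : Measure E := Measure.addHaar
  have hμ : 0 < μ.real (ball 0 1) :=
    ENNReal.toReal_pos (measure_ball_pos μ 0 one_pos).ne' measure_ball_lt_top.ne
  have hsub : ball 0 (1 + δ) ⊆ ball 0 1 ∪ ⋃ x ∈ K, ball x (2 * δ) := by
    intro y hy
    rw [mem_ball_zero_iff] at hy
    rcases lt_or_ge ‖y‖ 1 with h1 | h1
    · exact Or.inl (mem_ball_zero_iff.2 h1)
    · have hy0 : 0 < ‖y‖ := by linarith
      obtain ⟨x, hx, hxd⟩ := hK (‖y‖⁻¹ • y) (by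
        rw [norm_smul, norm_inv, norm_norm, inv_mul_cancel₀ hy0.ne'])
      have hdist : dist y (‖y‖⁻¹ • y) = ‖y‖ - 1 := by
        calc dist y (‖y‖⁻¹ • y) = ‖(1 - ‖y‖⁻¹) • y‖ := by rw [dist_eq_norm, sub_smul, one_smul]
          _ = ‖y‖ - 1 := by
            rw [norm_smul, Real.norm_of_nonneg (sub_nonneg.2 (inv_le_one_of_one_le₀ h1))]
            field_simp
      refine Or.inr (Set.mem_iUnion₂.2 ⟨x, hx, ?_⟩)
      rw [mem_ball]
      linarith [dist_triangle y (‖y‖⁻¹ • y) x]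
  have hfin : μ (ball 0 1 ∪ ⋃ x ∈ K, ball x (2 * δ)) ≠ ⊤ :=
    (measure_union_lt_top measure_ball_lt_top ((measure_biUnion_lt_top K.finite_toSet
      fun _ _ ↦ measure_ball_lt_top))).ne
  have h := ((measureReal_mono hsub hfin).trans (measureReal_union_le _ _)).trans
    (add_le_add_right (measureReal_biUnion_finset_le K fun x ↦ ball x (2 * δ)) _)
  simp only [measureReal_ball_eq_pow_finrank_mul μ _ (by linarith : 0 < 2 * δ),
    measureReal_ball_eq_pow_finrank_mul μ _ (by linarith : 0 < 1 + δ),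
    Finset.sum_const, nsmul_eq_mul] at h
  refine le_of_mul_le_mul_right ?_ hμ
  linarith

theorem one_div_cosh_le_dist_iff {n : ℕ} {x y : EuclideanSpace ℝ (Fin n)} (hx : ‖x‖ = 1)
    (hy : ‖y‖ = 1) (r : ℝ) :
    1 / Real.cosh r ≤ dist x y ↔ ⟪x, y⟫ ≤ Real.cosh (2 * r) / (1 + Real.cosh (2 * r)) := by
  have hk : 0 < Real.cosh r := Real.cosh_pos r
  have ht : Real.cosh (2 * r) / (1 + Real.cosh (2 * r)) = 1 - (1 / Real.cosh r) ^ 2 / 2 := by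
    have h : Real.cosh (2 * r) = 2 * Real.cosh r ^ 2 - 1 := by
      rw [Real.cosh_two_mul, Real.sinh_sq]
      ring
    rw [h, add_sub_cancel]
    field_simp
  rw [ht, ← sq_le_sq₀ (by positivity) dist_nonneg, dist_eq_norm, norm_sub_sq_real, hx, hy]
  constructor <;> intro h <;> linarith

/-- The cardinality of a spherical code is of order at most `(cosh r) ^ (n - 1)`. -/
theorem IsSphericalCode.card_le {m : ℕ} {r : ℝ} {K : Finset (EuclideanSpace ℝ (Fin (m + 1)))}
    (hK : IsSphericalCode (m + 1) (Real.cosh (2 * r) / (1 + Real.cosh (2 * r))) K) :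
    (K.card : ℝ) ≤ (2 ^ (m + 1) + (m + 1)) * 2 ^ m * Real.cosh r ^ m := by
  have hk : 1 ≤ Real.cosh r := Real.one_le_cosh r
  set s := 1 / Real.cosh r / 2 with hs
  have hs0 : 0 < s := by positivity
  have hs1 : s ≤ 1 / 2 := by
    have : 1 / Real.cosh r ≤ 1 := (div_le_one (by positivity)).2 hk
    linarith
  have h := card_mul_pow_le_of_pairwise_le_dist hs0 (by linarith) hK.1 fun x hx y hy hxy ↦ by
    rw [hs, mul_div_cancel₀ _ two_ne_zero]
    exact (one_div_cosh_le_dist_iff (hK.1 x hx) (hK.1 y hy) r).2 (hK.2 x hx y hy hxy)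
  rw [finrank_euclideanSpace_fin] at h
  have hlow := one_add_mul_le_pow (by linarith : -2 ≤ -s) (m + 1)
  have hupp := one_add_pow_le_one_add_mul hs0.le (by linarith) (m + 1)
  rw [← sub_eq_add_neg 1 s] at hlow
  push_cast at hlow
  have hmul : (K.card : ℝ) * s ^ m ≤ 2 ^ (m + 1) + (m + 1) := by
    refine le_of_mul_le_mul_right ?_ hs0
    rw [mul_assoc, ← pow_succ]
    linarith
  calc (K.card : ℝ) = K.card * s ^ m * (2 * Real.cosh r) ^ m := by
        rw [mul_assoc, ← mul_pow, hs]
        field_simp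
        simp
    _ ≤ (2 ^ (m + 1) + (m + 1)) * (2 * Real.cosh r) ^ m := by gcongr
    _ = _ := by rw [mul_pow, mul_assoc]

/-- A spherical code of maximal cardinality has order at least `(cosh r) ^ (n - 1)`. -/
theorem exists_isSphericalCode_le_card (m : ℕ) (r : ℝ) :
    ∃ K, IsSphericalCode (m + 1) (Real.cosh (2 * r) / (1 + Real.cosh (2 * r))) K ∧
      Real.cosh r ^ m / 2 ^ (m + 1) ≤ (K.card : ℝ) := by
  classical
  set t := Real.cosh (2 * r) / (1 + Real.cosh (2 * r))
  let S : Set ℕ := {k | ∃ K, IsSphericalCode (m + 1) t K ∧ K.card = k}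
  have hne : S.Nonempty := ⟨0, ∅, by simp [IsSphericalCode], rfl⟩
  have hbdd : BddAbove S := by
    refine ⟨⌊(2 ^ (m + 1) + (m + 1)) * 2 ^ m * Real.cosh r ^ m⌋₊, ?_⟩
    rintro _ ⟨K, hK, rfl⟩
    exact Nat.le_floor hK.card_le
  obtain ⟨K, hK, hcard⟩ := Nat.sSup_mem hne hbdd
  refine ⟨K, hK, ?_⟩
  have hk : 0 < Real.cosh r := Real.cosh_pos r
  have hcover : ∀ u : EuclideanSpace ℝ (Fin (m + 1)), ‖u‖ = 1 →
      ∃ x ∈ K, dist u x < 1 / Real.cosh r := by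
    intro u hu
    by_contra! hfar
    have huK : u ∉ K := fun h ↦ by
      have := hfar u h
      rw [dist_self] at this
      exact absurd this (not_le.2 (by positivity))
    have hle : ∀ x ∈ K, ⟪u, x⟫ ≤ t := fun x hx ↦
      (one_div_cosh_le_dist_iff hu (hK.1 x hx) r).1 (hfar x hx)
    have hmem : (insert u K).card ∈ S := by
      refine ⟨insert u K, ⟨?_, ?_⟩, rfl⟩
      · simpa [hu] using hK.1
      · intro x hx y hy hxy
        rcases Finset.mem_insert.1 hx with rfl | hxK <;>
          rcases Finset.mem_insert.1 hy with rfl | hyK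
        · exact absurd rfl hxy
        · exact hle y hyK
        · exact real_inner_comm x y ▸ hle x hxK
        · exact hK.2 x hxK y hyK hxy
    have := le_csSup hbdd hmem
    rw [Finset.card_insert_of_notMem huK] at this
    omega
  set δ := 1 / Real.cosh r with hδ
  have hδ0 : 0 < δ := by positivity
  have h := sub_one_le_card_mul_pow_of_exists_dist_lt hδ0 hcover
  rw [finrank_euclideanSpace_fin] at h
  have hlow := one_add_mul_le_pow (by linarith : -2 ≤ δ) (m + 1)
  push_cast at hlow
  have hmul : 1 ≤ (K.card : ℝ) * (2 ^ (m + 1) * δ ^ m) := by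
    refine le_of_mul_le_mul_right ?_ hδ0
    have hm : 0 ≤ (m : ℝ) * δ := by positivity
    calc 1 * δ ≤ K.card * (2 * δ) ^ (m + 1) := by linarith
      _ = K.card * (2 ^ (m + 1) * δ ^ m) * δ := by ring
  rw [hδ, one_div, inv_pow, ← mul_assoc, ← div_eq_mul_inv, one_le_div (by positivity)] at hmul
  rwa [div_le_iff₀ (by positivity)]

/-- Corollary 2.6 (qualitative form): the hyperbolic kissing number grows
exponentially, of exact order e^((n-1)r), as r → ∞. -/
theorem kappa_H_exponential_growth (n : ℕ) (hn : 2 ≤ n) :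
    ∃ c C r₀ : ℝ, 0 < c ∧ c ≤ C ∧ 0 ≤ r₀ ∧
      ∀ r : ℝ, r₀ ≤ r →
        (∀ K : Finset (EuclideanSpace ℝ (Fin n)),
            IsSphericalCode n (Real.cosh (2 * r) / (1 + Real.cosh (2 * r))) K →
            (K.card : ℝ) ≤ C * Real.exp (((n : ℝ) - 1) * r)) ∧
        (∃ K : Finset (EuclideanSpace ℝ (Fin n)),
            IsSphericalCode n (Real.cosh (2 * r) / (1 + Real.cosh (2 * r))) K ∧
            c * Real.exp (((n : ℝ) - 1) * r) ≤ (K.card : ℝ)) := by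
  obtain ⟨m, rfl⟩ : ∃ m, n = m + 1 := ⟨n - 1, by omega⟩
  have hexp (r : ℝ) : Real.exp ((((m + 1 : ℕ) : ℝ) - 1) * r) = Real.exp r ^ m := by
    rw [Nat.cast_succ, add_sub_cancel_right, Real.exp_nat_mul]
  have h1 : (1 : ℝ) ≤ 2 ^ m := one_le_pow₀ one_le_two
  have h2 : (1 : ℝ) ≤ 2 ^ (m + 1) := one_le_pow₀ one_le_two
  refine ⟨1 / (2 ^ m * 2 ^ (m + 1)), (2 ^ (m + 1) + (m + 1)) * 2 ^ m, 0, by positivity, ?_, le_rfl,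
    fun r hr ↦ ⟨fun K hK ↦ ?_, ?_⟩⟩
  · calc 1 / ((2 : ℝ) ^ m * 2 ^ (m + 1)) ≤ 1 :=
          (div_le_one (by positivity)).2 (one_le_mul_of_one_le_of_one_le h1 h2)
      _ ≤ (2 ^ (m + 1) + (m + 1)) * 2 ^ m :=
          one_le_mul_of_one_le_of_one_le (by linarith [(Nat.cast_nonneg m : (0 : ℝ) ≤ m)]) h1
  · have hcosh : Real.cosh r ≤ Real.exp r := by
      rw [← Real.cosh_add_sinh]
      linarith [Real.sinh_nonneg_iff.2 hr]
    rw [hexp]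
    refine hK.card_le.trans ?_
    have := Real.cosh_pos r
    gcongr
  · obtain ⟨K, hK, hcard⟩ := exists_isSphericalCode_le_card m r
    refine ⟨K, hK, le_trans ?_ hcard⟩
    have hcosh : Real.exp r / 2 ≤ Real.cosh r := by
      rw [Real.cosh_eq]
      linarith [Real.exp_pos (-r)]
    calc 1 / (2 ^ m * 2 ^ (m + 1)) * Real.exp ((((m + 1 : ℕ) : ℝ) - 1) * r)
        = (Real.exp r / 2) ^ m / 2 ^ (m + 1) := by
          rw [hexp, div_pow]
          field_simp
      _ ≤ Real.cosh r ^ m / 2 ^ (m + 1) := by gcongr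
end
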